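/- arXiv:1211.6034 — 4 statements merged into one kernel-verified Lean document; each statement's English description precedes it below -/
import Mathlib

section
/- Let X and Y be real normed vector spaces, let σ† ∈ X, ρ > 0, and let F : X → Y be Fréchet differentiable at every point of the closed ball B_ρ(σ†). Assume (i) there is a constant C > 0 such that ‖F(σ+τ) − F(σ) − F'(σ)τ‖ ≤ C‖τ‖² for all σ ∈ B_ρ(σ†) and all τ ∈ X with σ+τ ∈ B_ρ(σ†) (quadratic Taylor remainder bound), and (ii) there is a constant c > 0 such that c‖τ‖ ≤ ‖F'(σ)τ‖ for all σ ∈ B_ρ(σ†) and all τ ∈ X (uniform linear stability of the linearization). Then there exist ρ' ∈ (0, ρ] and C' > 0 such that C'‖σ₂ − σ₁‖ ≤ ‖F(σ₂) − F(σ₁)‖ for all σ₁, σ₂ ∈ B_{ρ'}(σ†); in fact one may take any ρ' with 2Cρ' < c and C' = c − 2Cρ'. -/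
/-- Local Lipschitz-type stability of the nonlinear operator from uniform linear
stability of the linearization plus a quadratic Taylor remainder bound.
One may take any `ρ'` with `2Cρ' < c` and `C' = c - 2Cρ'`. -/
theorem lipschitz_stability_from_linearized_stability
    {X Y : Type*} [NormedAddCommGroup X] [NormedSpace ℝ X]
    [NormedAddCommGroup Y] [NormedSpace ℝ Y]
    (F : X → Y) (F' : X → X →L[ℝ] Y) (σdag : X) (ρ : ℝ) (hρ : 0 < ρ)
    (hdiff : ∀ σ ∈ Metric.closedBall σdag ρ, HasFDerivAt F (F' σ) σ)
    (C : ℝ) (hC : 0 < C)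
    (hTaylor : ∀ σ ∈ Metric.closedBall σdag ρ, ∀ τ : X,
      σ + τ ∈ Metric.closedBall σdag ρ →
      ‖F (σ + τ) - F σ - F' σ τ‖ ≤ C * ‖τ‖ ^ 2)
    (c : ℝ) (hc : 0 < c)
    (hstab : ∀ σ ∈ Metric.closedBall σdag ρ, ∀ τ : X, c * ‖τ‖ ≤ ‖F' σ τ‖) :
    (∃ ρ' C' : ℝ, 0 < ρ' ∧ ρ' ≤ ρ ∧ 0 < C' ∧
        ∀ σ₁ ∈ Metric.closedBall σdag ρ', ∀ σ₂ ∈ Metric.closedBall σdag ρ',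
          C' * ‖σ₂ - σ₁‖ ≤ ‖F σ₂ - F σ₁‖) ∧
    (∀ ρ' : ℝ, 0 < ρ' → ρ' ≤ ρ → 2 * C * ρ' < c →
        ∀ σ₁ ∈ Metric.closedBall σdag ρ', ∀ σ₂ ∈ Metric.closedBall σdag ρ',
          (c - 2 * C * ρ') * ‖σ₂ - σ₁‖ ≤ ‖F σ₂ - F σ₁‖) := by
  have key : ∀ ρ' : ℝ, 0 < ρ' → ρ' ≤ ρ → 2 * C * ρ' < c →
      ∀ σ₁ ∈ Metric.closedBall σdag ρ', ∀ σ₂ ∈ Metric.closedBall σdag ρ',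
        (c - 2 * C * ρ') * ‖σ₂ - σ₁‖ ≤ ‖F σ₂ - F σ₁‖ := by
    intro ρ' _ hle _ σ₁ h₁ σ₂ h₂
    have hball := Metric.closedBall_subset_closedBall (x := σdag) hle
    have hT := hTaylor σ₁ (hball h₁) (σ₂ - σ₁) (by simpa using hball h₂)
    rw [add_sub_cancel] at hT
    have hS := hstab σ₁ (hball h₁) (σ₂ - σ₁)
    have hN := norm_le_norm_add_norm_sub (F σ₂ - F σ₁) (F' σ₁ (σ₂ - σ₁))
    have hdiam : ‖σ₂ - σ₁‖ ≤ 2 * ρ' := by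
      rw [← dist_eq_norm]
      linarith [dist_triangle_right σ₂ σ₁ σdag, Metric.mem_closedBall.mp h₁,
        Metric.mem_closedBall.mp h₂]
    have hquad : C * ‖σ₂ - σ₁‖ ^ 2 ≤ 2 * C * ρ' * ‖σ₂ - σ₁‖ :=
      calc C * ‖σ₂ - σ₁‖ ^ 2 = C * ‖σ₂ - σ₁‖ * ‖σ₂ - σ₁‖ := by ring
        _ ≤ C * (2 * ρ') * ‖σ₂ - σ₁‖ := by gcongr
        _ = 2 * C * ρ' * ‖σ₂ - σ₁‖ := by ring
    linarith
  refine ⟨?_, key⟩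
  have hpos : 0 < min ρ (c / (4 * C)) := by positivity
  have hsmall : 2 * C * min ρ (c / (4 * C)) < c := by
    have h := (le_div_iff₀ (by positivity)).mp (min_le_right ρ (c / (4 * C)))
    linarith
  exact ⟨_, _, hpos, min_le_left _ _, sub_pos.mpr hsmall, key _ hpos (min_le_left _ _) hsmall⟩
end

section
/- Let X and Y be real normed vector spaces, let σ† ∈ X, ρ > 0, and let F : X → Y be Fréchet differentiable at every point of the closed ball B_ρ(σ†). Assume (i) there is a constant C > 0 such that ‖F(σ+τ) − F(σ) − F'(σ)τ‖ ≤ C‖τ‖² for all σ ∈ B_ρ(σ†) and all τ ∈ X with σ+τ ∈ B_ρ(σ†), and (ii) there is a constant c > 0 such that c‖τ‖ ≤ ‖F'(σ)τ‖ for all σ ∈ B_ρ(σ†) and all τ ∈ X. Then there exist ρ' ∈ (0, ρ] and a constant C̃ > 0 such that the tangential cone condition holds on B_{ρ'}(σ†): for all σ ∈ B_{ρ'}(σ†) and all τ with σ+τ ∈ B_{ρ'}(σ†), ‖F(σ+τ) − F(σ) − F'(σ)τ‖ ≤ C̃·‖τ‖·‖F(σ+τ) − F(σ)‖. -/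
/-- Main analytical result of the convergence analysis: the quadratic Taylor remainder
estimate and Lipschitz stability of the linearization yield the tangential cone
condition on some smaller ball. -/
theorem tangential_cone_from_linearized_stability
    {X Y : Type*} [NormedAddCommGroup X] [NormedSpace ℝ X]
    [NormedAddCommGroup Y] [NormedSpace ℝ Y]
    (F : X → Y) (F' : X → X →L[ℝ] Y) (σdag : X) (ρ : ℝ) (hρ : 0 < ρ)
    (hdiff : ∀ σ ∈ Metric.closedBall σdag ρ, HasFDerivAt F (F' σ) σ)
    (C : ℝ) (hC : 0 < C)
    (hTaylor : ∀ σ ∈ Metric.closedBall σdag ρ, ∀ τ : X,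
      σ + τ ∈ Metric.closedBall σdag ρ →
      ‖F (σ + τ) - F σ - F' σ τ‖ ≤ C * ‖τ‖ ^ 2)
    (c : ℝ) (hc : 0 < c)
    (hstab : ∀ σ ∈ Metric.closedBall σdag ρ, ∀ τ : X, c * ‖τ‖ ≤ ‖F' σ τ‖) :
    ∃ ρ' Ctil : ℝ, 0 < ρ' ∧ ρ' ≤ ρ ∧ 0 < Ctil ∧
      ∀ σ ∈ Metric.closedBall σdag ρ', ∀ τ : X,
        σ + τ ∈ Metric.closedBall σdag ρ' →
        ‖F (σ + τ) - F σ - F' σ τ‖ ≤ Ctil * ‖τ‖ * ‖F (σ + τ) - F σ‖ := by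
  refine ⟨min ρ (c / (4 * C)), 2 * C / c, by positivity, min_le_left _ _, by positivity, ?_⟩
  intro σ hσ τ hστ
  have hsub := Metric.closedBall_subset_closedBall (x := σdag) (min_le_left ρ (c / (4 * C)))
  have hrem := hTaylor σ (hsub hσ) τ (hsub hστ)
  have hlow := hstab σ (hsub hσ) τ
  have hτ : ‖τ‖ ≤ c / (4 * C) + c / (4 * C) := by
    have h := dist_triangle_right (σ + τ) σ σdag
    rw [dist_self_add_left] at h
    exact h.trans (add_le_add (hστ.trans (min_le_right _ _)) (hσ.trans (min_le_right _ _)))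
  have hCτ : C * ‖τ‖ ≤ c / 2 := by
    calc C * ‖τ‖ ≤ C * (c / (4 * C) + c / (4 * C)) := by gcongr
      _ = c / 2 := by field_simp; norm_num
  have hquad : C * ‖τ‖ ^ 2 ≤ c / 2 * ‖τ‖ := by
    rw [sq, ← mul_assoc]
    gcongr
  have htri : ‖F' σ τ‖ ≤ ‖F (σ + τ) - F σ‖ + ‖F (σ + τ) - F σ - F' σ τ‖ :=
    norm_le_norm_add_norm_sub _ _
  have hdiff_low : c / 2 * ‖τ‖ ≤ ‖F (σ + τ) - F σ‖ := by linarith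
  calc ‖F (σ + τ) - F σ - F' σ τ‖ ≤ C * ‖τ‖ ^ 2 := hrem
    _ = 2 * C / c * ‖τ‖ * (c / 2 * ‖τ‖) := by field_simp
    _ ≤ 2 * C / c * ‖τ‖ * ‖F (σ + τ) - F σ‖ := by gcongr
end

section
/- Let a, b ∈ ℝ with a² + b² = 1, and define u : ℝ² → ℝ by u(x,y) = ax + by and w : ℝ² → ℝ by w(x,y) = −(x² + y²)/4 + 1/4. Then: (a) u is harmonic on ℝ², i.e., ∂²u/∂x² + ∂²u/∂y² = 0 everywhere; (b) w(x,y) = 0 for every (x,y) on the unit circle x² + y² = 1; (c) at every point of ℝ², ∂²w/∂x² + ∂²w/∂y² = −(|∇u|² + u·(∂²u/∂x² + ∂²u/∂y²)), i.e., Δw = −div(u∇u), so w solves the linearized potential equation with right-hand side direction τ = u and homogeneous Dirichlet boundary conditions on the unit disk; and (d) at every point of ℝ², |∇u|²·u + 2·(∇u · ∇w) = 0, so the linearized power density E'(1)u = |∇u|²u + 2σ∇u·∇(u'(σ)u) with σ ≡ 1 vanishes identically on the unit disk. -/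
/-- Partial derivative with respect to the first coordinate of a function on `ℝ²`. -/
noncomputable def pdx (f : ℝ × ℝ → ℝ) (p : ℝ × ℝ) : ℝ :=
  deriv (fun x => f (x, p.2)) p.1

/-- Partial derivative with respect to the second coordinate of a function on `ℝ²`. -/
noncomputable def pdy (f : ℝ × ℝ → ℝ) (p : ℝ × ℝ) : ℝ :=
  deriv (fun y => f (p.1, y)) p.2

theorem hasDerivAt_quadratic (k l m t : ℝ) :
    HasDerivAt (fun x => k * x ^ 2 + l * x + m) (2 * k * t + l) t := by
  refine HasDerivAt.congr_deriv
    ((((hasDerivAt_pow 2 t).const_mul k).add ((hasDerivAt_id t).const_mul l)).add_const m) ?_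
  norm_num
  ring

theorem pdx_quadratic (A B a b c : ℝ) :
    pdx (fun p => A * p.1 ^ 2 + B * p.2 ^ 2 + a * p.1 + b * p.2 + c) =
      fun p => 2 * A * p.1 + a := by
  funext p
  refine ((hasDerivAt_quadratic A a (B * p.2 ^ 2 + b * p.2 + c) p.1).congr_of_eventuallyEq
    (.of_forall fun x => ?_)).deriv
  ring

theorem pdy_quadratic (A B a b c : ℝ) :
    pdy (fun p => A * p.1 ^ 2 + B * p.2 ^ 2 + a * p.1 + b * p.2 + c) =
      fun p => 2 * B * p.2 + b := by
  funext p
  refine ((hasDerivAt_quadratic B b (A * p.1 ^ 2 + a * p.1 + c) p.2).congr_of_eventuallyEq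
    (.of_forall fun y => ?_)).deriv
  ring

theorem pdx_pdx_quadratic (A B a b c : ℝ) :
    pdx (pdx fun p => A * p.1 ^ 2 + B * p.2 ^ 2 + a * p.1 + b * p.2 + c) =
      fun _ => 2 * A := by
  rw [pdx_quadratic]
  simpa using pdx_quadratic 0 0 (2 * A) 0 a

theorem pdy_pdy_quadratic (A B a b c : ℝ) :
    pdy (pdy fun p => A * p.1 ^ 2 + B * p.2 ^ 2 + a * p.1 + b * p.2 + c) =
      fun _ => 2 * B := by
  rw [pdy_quadratic]
  simpa using pdy_quadratic 0 0 0 (2 * B) b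

/-- The explicit example showing that for a single measurement the linearized power
density operator need not be injective: on the unit disk with `σ ≡ 1` and boundary
voltage `f(x,y) = ax + by` (with `(a,b)` a unit vector), the function
`u(x,y) = ax + by` lies in the kernel of `E'(σ)`, with corresponding linearized
potential `w(x,y) = -(x² + y²)/4 + 1/4`:
(a) `u` is harmonic; (b) `w` vanishes on the unit circle;
(c) `Δw = -div(u∇u)`; (d) `|∇u|²·u + 2∇u·∇w = 0` everywhere. -/
theorem kernel_example_single_measurement
    (a b : ℝ) (hab : a ^ 2 + b ^ 2 = 1)
    (u w : ℝ × ℝ → ℝ)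
    (hu : ∀ p : ℝ × ℝ, u p = a * p.1 + b * p.2)
    (hw : ∀ p : ℝ × ℝ, w p = -(p.1 ^ 2 + p.2 ^ 2) / 4 + 1 / 4) :
    (∀ p : ℝ × ℝ, pdx (pdx u) p + pdy (pdy u) p = 0) ∧
    (∀ p : ℝ × ℝ, p.1 ^ 2 + p.2 ^ 2 = 1 → w p = 0) ∧
    (∀ p : ℝ × ℝ, pdx (pdx w) p + pdy (pdy w) p =
      -(((pdx u p) ^ 2 + (pdy u p) ^ 2)
        + u p * (pdx (pdx u) p + pdy (pdy u) p))) ∧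
    (∀ p : ℝ × ℝ, ((pdx u p) ^ 2 + (pdy u p) ^ 2) * u p
      + 2 * (pdx u p * pdx w p + pdy u p * pdy w p) = 0) := by
  obtain rfl : u = fun p => 0 * p.1 ^ 2 + 0 * p.2 ^ 2 + a * p.1 + b * p.2 + 0 := by
    funext p
    rw [hu p]
    ring
  obtain rfl : w = fun p =>
      (-1 / 4) * p.1 ^ 2 + (-1 / 4) * p.2 ^ 2 + 0 * p.1 + 0 * p.2 + 1 / 4 := by
    funext p
    rw [hw p]
    ring
  simp only [pdx_pdx_quadratic, pdy_pdy_quadratic]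
  simp only [pdx_quadratic, pdy_quadratic]
  refine ⟨fun p => by ring, fun p hp => ?_, fun p => ?_, fun p => ?_⟩
  · linear_combination (-1 / 4) * hp
  · linear_combination hab
  · linear_combination (a * p.1 + b * p.2) * hab
end

section
/- Let X and Y be real normed vector spaces, let σ† ∈ X, ρ > 0, and let F : X → Y be Fréchet differentiable at every point of the closed ball B_ρ(σ†). Assume (i) there is a constant C > 0 such that ‖F(σ+τ) − F(σ) − F'(σ)τ‖ ≤ C‖τ‖² for all σ ∈ B_ρ(σ†) and all τ ∈ X with σ+τ ∈ B_ρ(σ†), and (ii) there is a constant c > 0 such that c‖τ‖ ≤ ‖F'(σ)τ‖ for all σ ∈ B_ρ(σ†) and all τ ∈ X. Then there exists ρ' ∈ (0, ρ] such that F is injective on B_{ρ'}(σ†): for all σ₁, σ₂ ∈ B_{ρ'}(σ†), F(σ₁) = F(σ₂) implies σ₁ = σ₂. -/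
/-- Local injectivity of the nonlinear operator from uniform linear stability of
the linearization plus a quadratic Taylor remainder bound. -/
theorem local_injectivity_from_linearized_stability
    {X Y : Type*} [NormedAddCommGroup X] [NormedSpace ℝ X]
    [NormedAddCommGroup Y] [NormedSpace ℝ Y]
    (F : X → Y) (F' : X → X →L[ℝ] Y) (σdag : X) (ρ : ℝ) (hρ : 0 < ρ)
    (hdiff : ∀ σ ∈ Metric.closedBall σdag ρ, HasFDerivAt F (F' σ) σ)
    (C : ℝ) (hC : 0 < C)
    (hTaylor : ∀ σ ∈ Metric.closedBall σdag ρ, ∀ τ : X,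
      σ + τ ∈ Metric.closedBall σdag ρ →
      ‖F (σ + τ) - F σ - F' σ τ‖ ≤ C * ‖τ‖ ^ 2)
    (c : ℝ) (hc : 0 < c)
    (hstab : ∀ σ ∈ Metric.closedBall σdag ρ, ∀ τ : X, c * ‖τ‖ ≤ ‖F' σ τ‖) :
    ∃ ρ' : ℝ, 0 < ρ' ∧ ρ' ≤ ρ ∧
      ∀ σ₁ ∈ Metric.closedBall σdag ρ', ∀ σ₂ ∈ Metric.closedBall σdag ρ',
        F σ₁ = F σ₂ → σ₁ = σ₂ := by
  refine ⟨min ρ (c / (4 * C)), lt_min hρ (by positivity), min_le_left _ _, ?_⟩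
  intro σ₁ h₁ σ₂ h₂ hF
  have hsub := Metric.closedBall_subset_closedBall (x := σdag) (min_le_left ρ (c / (4 * C)))
  have hT := hTaylor σ₁ (hsub h₁) (σ₂ - σ₁) (by simpa using hsub h₂)
  rw [add_sub_cancel, hF, sub_self, zero_sub, norm_neg] at hT
  have hquad := (hstab σ₁ (hsub h₁) (σ₂ - σ₁)).trans hT
  have hsmall : ‖σ₂ - σ₁‖ ≤ c / (4 * C) + c / (4 * C) := by
    rw [← dist_eq_norm]
    exact (dist_triangle_right σ₂ σ₁ σdag).trans
      (add_le_add ((Metric.mem_closedBall.mp h₂).trans (min_le_right _ _))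
        ((Metric.mem_closedBall.mp h₁).trans (min_le_right _ _)))
  have hCsmall : C * ‖σ₂ - σ₁‖ ≤ c / 2 := by
    calc C * ‖σ₂ - σ₁‖ ≤ C * (c / (4 * C) + c / (4 * C)) := by gcongr
      _ = c / 2 := by field_simp; norm_num
  by_contra hne
  have hpos : 0 < ‖σ₂ - σ₁‖ := norm_pos_iff.mpr (sub_ne_zero.mpr (Ne.symm hne))
  nlinarith [mul_le_mul_of_nonneg_right hCsmall hpos.le, mul_pos hc hpos]
end
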